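/- arXiv:2512.23521 — 5 statements merged into one kernel-verified Lean document; each statement's English description precedes it below -/
import Mathlib

section
/- Let m, n ∈ ℕ and s, r', r'' ∈ ℝ satisfy s ≤ r' + min{0, r''} and s ≤ r'' + min{0, r'}. Then for all ξ ∈ ℝ^m and η ∈ ℝ^n one has ⟨(ξ,η)⟩^s ≤ ⟨ξ⟩^{r'} · ⟨η⟩^{r''}, where (ξ,η) ∈ ℝ^{m+n} is the concatenated vector. -/
open scoped ENNReal

/-- The Japanese bracket `⟨x⟩ = (1 + |x|²)^(1/2)`. -/
noncomputable def jb {E : Type*} [NormedAddCommGroup E] (x : E) : ℝ :=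
  Real.sqrt (1 + ‖x‖ ^ 2)

/-- Concatenation of `ξ ∈ ℝ^m` and `η ∈ ℝ^n` into `(ξ, η) ∈ ℝ^(m+n)`. -/
noncomputable def concatE {m n : ℕ} (ξ : EuclideanSpace ℝ (Fin m))
    (η : EuclideanSpace ℝ (Fin n)) : EuclideanSpace ℝ (Fin (m + n)) :=
  (EuclideanSpace.equiv (Fin (m + n)) ℝ).symm
    (Fin.append (fun i => ξ i) (fun j => η j))

theorem one_le_jb {E : Type*} [NormedAddCommGroup E] (x : E) : 1 ≤ jb x :=
  Real.one_le_sqrt.2 (by linarith [sq_nonneg ‖x‖])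

theorem jb_sq {E : Type*} [NormedAddCommGroup E] (x : E) : jb x ^ 2 = 1 + ‖x‖ ^ 2 :=
  Real.sq_sqrt (by positivity)

theorem norm_concatE_sq {m n : ℕ} (ξ : EuclideanSpace ℝ (Fin m))
    (η : EuclideanSpace ℝ (Fin n)) : ‖concatE ξ η‖ ^ 2 = ‖ξ‖ ^ 2 + ‖η‖ ^ 2 := by
  simp [EuclideanSpace.norm_sq_eq, concatE, Fin.sum_univ_add]

theorem jb_concatE_sq {m n : ℕ} (ξ : EuclideanSpace ℝ (Fin m))
    (η : EuclideanSpace ℝ (Fin n)) : jb (concatE ξ η) ^ 2 = jb ξ ^ 2 + jb η ^ 2 - 1 := by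
  simp only [jb_sq, norm_concatE_sq]
  ring

/-- A power of a number in `[1, c]` is at least the power of `c` to the negative part
of the exponent. -/
theorem rpow_min_zero_le {a c : ℝ} (ha : 1 ≤ a) (hac : a ≤ c) (r : ℝ) :
    c ^ min 0 r ≤ a ^ r :=
  (Real.rpow_le_rpow_of_nonpos (by linarith) hac (min_le_left 0 r)).trans
    (Real.rpow_le_rpow_of_exponent_le ha (min_le_right 0 r))

theorem rpow_le_rpow_mul_rpow {a b c s r' r'' : ℝ} (ha : 1 ≤ a) (hb : 1 ≤ b)
    (hac : a ≤ c) (hbc : b ≤ c) (hc : c ≤ a * b)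
    (h1 : s ≤ r' + min 0 r'') (h2 : s ≤ r'' + min 0 r') :
    c ^ s ≤ a ^ r' * b ^ r'' := by
  have hc1 : 1 ≤ c := ha.trans hac
  rcases le_total 0 s with hs | hs
  · calc c ^ s ≤ (a * b) ^ s := Real.rpow_le_rpow (by linarith) hc hs
      _ = a ^ s * b ^ s := Real.mul_rpow (by linarith) (by linarith)
      _ ≤ a ^ r' * b ^ r'' := by
        gcongr
        · linarith [min_le_left 0 r'']
        · linarith [min_le_left 0 r']
  · calc c ^ s ≤ c ^ (min 0 r' + min 0 r'') := by
          refine Real.rpow_le_rpow_of_exponent_le hc1 ?_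
          rcases min_cases 0 r' with h | h <;> rcases min_cases 0 r'' with h' | h' <;> linarith
      _ = c ^ min 0 r' * c ^ min 0 r'' := Real.rpow_add (by linarith) _ _
      _ ≤ a ^ r' * b ^ r'' :=
        mul_le_mul (rpow_min_zero_le ha hac r') (rpow_min_zero_le hb hbc r'')
          (by positivity) (by positivity)

theorem stmt_0 (m n : ℕ) (s r' r'' : ℝ)
    (h1 : s ≤ r' + min 0 r'') (h2 : s ≤ r'' + min 0 r')
    (ξ : EuclideanSpace ℝ (Fin m)) (η : EuclideanSpace ℝ (Fin n)) :
    jb (concatE ξ η) ^ s ≤ jb ξ ^ r' * jb η ^ r'' := by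
  have ha := one_le_jb ξ
  have hb := one_le_jb η
  have hc := one_le_jb (concatE ξ η)
  have hsq := jb_concatE_sq ξ η
  have ha2 : 1 ≤ jb ξ ^ 2 := one_le_pow₀ ha
  have hb2 : 1 ≤ jb η ^ 2 := one_le_pow₀ hb
  refine rpow_le_rpow_mul_rpow ha hb ?_ ?_ ?_ h1 h2
  · exact le_of_pow_le_pow_left₀ two_ne_zero (by linarith) (by linarith)
  · exact le_of_pow_le_pow_left₀ two_ne_zero (by linarith) (by linarith)
  · refine le_of_pow_le_pow_left₀ two_ne_zero (by positivity) ?_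
    rw [mul_pow, hsq]
    nlinarith [mul_nonneg (sub_nonneg.2 ha2) (sub_nonneg.2 hb2)]
end

section
/- Let k ∈ ℕ and s ∈ ℝ. For all measurable functions f, g : ℝ^k → [0,∞] one has (∫_{ℝ^k} ⟨x⟩^{2s} (∫_{ℝ^k} f(y) g(x−y) dy)² dx)^{1/2} ≤ 2^{|s|} · (∫_{ℝ^k} ⟨y⟩^{|s|} f(y) dy) · (∫_{ℝ^k} ⟨z⟩^{2s} g(z)² dz)^{1/2}, where all integrals are Lebesgue integrals with values in [0,∞]. -/
open scoped ENNReal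
open MeasureTheory

section JapaneseBracket

variable {E : Type*} [NormedAddCommGroup E]

lemma jb_pos (x : E) : 0 < jb x := Real.sqrt_pos.2 (by positivity)

lemma jb_neg (x : E) : jb (-x) = jb x := by simp [jb]

lemma measurable_jb [MeasurableSpace E] [OpensMeasurableSpace E] :
    Measurable (jb : E → ℝ) := by
  unfold jb
  fun_prop

lemma jb_add_le (x y : E) : jb (x + y) ≤ 2 * (jb x * jb y) := by
  unfold jb
  rw [← Real.sqrt_mul (by positivity), Real.sqrt_le_left (by positivity), mul_pow,
    Real.sq_sqrt (by positivity)]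
  have h : ‖x + y‖ ^ 2 ≤ (‖x‖ + ‖y‖) ^ 2 := by
    gcongr
    exact norm_add_le x y
  nlinarith [sq_nonneg (‖x‖ - ‖y‖), sq_nonneg (‖x‖ * ‖y‖), sq_nonneg ‖x‖, sq_nonneg ‖y‖]

/-- Peetre's inequality. -/
lemma jb_rpow_le (s : ℝ) (x y : E) :
    jb x ^ s ≤ 2 ^ |s| * (jb y ^ |s| * jb (x - y) ^ s) := by
  have hx := jb_pos x
  have hy := jb_pos y
  have hxy := jb_pos (x - y)
  rcases le_total 0 s with hs | hs
  · rw [abs_of_nonneg hs, ← Real.mul_rpow hy.le hxy.le,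
      ← Real.mul_rpow two_pos.le (by positivity)]
    refine Real.rpow_le_rpow hx.le ?_ hs
    simpa using jb_add_le y (x - y)
  · have h : jb (x - y) ≤ 2 * (jb x * jb y) := by
      simpa [sub_eq_add_neg, jb_neg] using jb_add_le x (-y)
    have h' := Real.rpow_le_rpow hxy.le h (neg_nonneg.2 hs)
    rw [Real.mul_rpow two_pos.le (by positivity), Real.mul_rpow hx.le hy.le,
      Real.rpow_neg hxy.le, Real.rpow_neg hx.le] at h'
    rw [abs_of_nonpos hs]
    have hxs : 0 < jb x ^ s := Real.rpow_pos_of_pos hx s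
    have hxys : 0 < jb (x - y) ^ s := Real.rpow_pos_of_pos hxy s
    calc jb x ^ s = (jb x ^ s * jb (x - y) ^ s) * (jb (x - y) ^ s)⁻¹ := by field_simp
      _ ≤ (jb x ^ s * jb (x - y) ^ s) * (2 ^ (-s) * ((jb x ^ s)⁻¹ * jb y ^ (-s))) := by
        gcongr
      _ = 2 ^ (-s) * (jb y ^ (-s) * jb (x - y) ^ s) := by field_simp

end JapaneseBracket

lemma sq_lintegral_mul_le {α : Type*} [MeasurableSpace α] {μ : Measure α} {f g : α → ℝ≥0∞}
    (hf : Measurable f) (hg : Measurable g) :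
    (∫⁻ y, f y * g y ∂μ) ^ 2 ≤ (∫⁻ y, f y ∂μ) * ∫⁻ y, f y * g y ^ 2 ∂μ := by
  have hroot (a : ℝ≥0∞) : (a ^ (1 / 2 : ℝ)) ^ 2 = a := by
    rw [← ENNReal.rpow_natCast, ← ENNReal.rpow_mul]
    norm_num
  have h := ENNReal.lintegral_mul_le_Lp_mul_Lq μ Real.HolderConjugate.two_two
    (f := fun y ↦ f y ^ (1 / 2 : ℝ)) (g := fun y ↦ f y ^ (1 / 2 : ℝ) * g y)
    (by fun_prop) (by fun_prop)
  simp only [Pi.mul_apply, ENNReal.rpow_two, mul_pow, hroot, ← mul_assoc, ← sq] at h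
  calc (∫⁻ y, f y * g y ∂μ) ^ 2
      ≤ ((∫⁻ y, f y ∂μ) ^ (1 / 2 : ℝ) * (∫⁻ y, f y * g y ^ 2 ∂μ) ^ (1 / 2 : ℝ)) ^ 2 := by
        gcongr
    _ = _ := by rw [mul_pow, hroot, hroot]

/-- Young's convolution inequality `L¹ * L² ⊆ L²`. -/
lemma lintegral_sq_conv_le {G : Type*} [AddGroup G] [MeasurableSpace G] [MeasurableAdd₂ G]
    [MeasurableNeg G] {μ : Measure G} [SFinite μ] [μ.IsAddRightInvariant]
    {f g : G → ℝ≥0∞} (hf : Measurable f) (hg : Measurable g) :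
    ∫⁻ x, (∫⁻ y, f y * g (x - y) ∂μ) ^ 2 ∂μ ≤ (∫⁻ y, f y ∂μ) ^ 2 * ∫⁻ z, g z ^ 2 ∂μ := by
  calc ∫⁻ x, (∫⁻ y, f y * g (x - y) ∂μ) ^ 2 ∂μ
      ≤ ∫⁻ x, (∫⁻ y, f y ∂μ) * ∫⁻ y, f y * g (x - y) ^ 2 ∂μ ∂μ :=
        lintegral_mono fun x ↦ sq_lintegral_mul_le hf (by fun_prop)
    _ = (∫⁻ y, f y ∂μ) * ∫⁻ x, ∫⁻ y, f y * g (x - y) ^ 2 ∂μ ∂μ :=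
        lintegral_const_mul _ (Measurable.lintegral_prod_right (by fun_prop))
    _ = (∫⁻ y, f y ∂μ) * ∫⁻ y, ∫⁻ x, f y * g (x - y) ^ 2 ∂μ ∂μ := by
        rw [lintegral_lintegral_swap (by fun_prop)]
    _ = (∫⁻ y, f y ∂μ) * ∫⁻ y, f y * ∫⁻ z, g z ^ 2 ∂μ ∂μ := by
        congr 2 with y
        rw [lintegral_const_mul _ (by fun_prop), lintegral_sub_right_eq_self (fun z ↦ g z ^ 2) y]
    _ = (∫⁻ y, f y ∂μ) ^ 2 * ∫⁻ z, g z ^ 2 ∂μ := by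
        rw [lintegral_mul_const _ hf, sq, mul_assoc]

lemma ofReal_jb_rpow_two_mul {E : Type*} [NormedAddCommGroup E] (s : ℝ) (x : E) :
    ENNReal.ofReal (jb x ^ (2 * s)) = ENNReal.ofReal (jb x ^ s) ^ 2 := by
  rw [← ENNReal.ofReal_pow (Real.rpow_nonneg (jb_pos x).le s), mul_comm,
    Real.rpow_mul (jb_pos x).le, Real.rpow_two]

theorem stmt_2 (k : ℕ) (s : ℝ)
    (f g : EuclideanSpace ℝ (Fin k) → ℝ≥0∞) (hf : Measurable f) (hg : Measurable g) :
    (∫⁻ x, ENNReal.ofReal (jb x ^ (2 * s)) * (∫⁻ y, f y * g (x - y)) ^ 2) ^ (1 / 2 : ℝ)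
      ≤ ENNReal.ofReal ((2 : ℝ) ^ |s|)
        * (∫⁻ y, ENNReal.ofReal (jb y ^ |s|) * f y)
        * (∫⁻ z, ENNReal.ofReal (jb z ^ (2 * s)) * (g z) ^ 2) ^ (1 / 2 : ℝ) := by
  have hjb (t : ℝ) :
      Measurable fun x : EuclideanSpace ℝ (Fin k) ↦ ENNReal.ofReal (jb x ^ t) :=
    (measurable_jb.pow_const t).ennreal_ofReal
  set c := ENNReal.ofReal ((2 : ℝ) ^ |s|)
  set F := fun y ↦ ENNReal.ofReal (jb y ^ |s|) * f y
  set G := fun z ↦ ENNReal.ofReal (jb z ^ s) * g z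
  have hF : Measurable F := (hjb _).mul hf
  have hG : Measurable G := (hjb _).mul hg
  have hpointwise (x : EuclideanSpace ℝ (Fin k)) :
      ENNReal.ofReal (jb x ^ s) * ∫⁻ y, f y * g (x - y) ≤ c * ∫⁻ y, F y * G (x - y) := by
    rw [← lintegral_const_mul _ (by fun_prop), ← lintegral_const_mul _ (by fun_prop)]
    refine lintegral_mono fun y ↦ ?_
    have h := ENNReal.ofReal_le_ofReal (jb_rpow_le s x y)
    rw [ENNReal.ofReal_mul (by positivity),
      ENNReal.ofReal_mul (Real.rpow_nonneg (jb_pos y).le _)] at h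
    calc _ ≤ c * (ENNReal.ofReal (jb y ^ |s|) * ENNReal.ofReal (jb (x - y) ^ s)) *
          (f y * g (x - y)) := by gcongr
      _ = _ := by simp only [F, G]; ring
  simp only [ofReal_jb_rpow_two_mul, ← mul_pow]
  have hmain : ∫⁻ x, (ENNReal.ofReal (jb x ^ s) * ∫⁻ y, f y * g (x - y)) ^ 2 ≤
      (c * ∫⁻ y, F y) ^ 2 * ∫⁻ z, G z ^ 2 := by
    calc _ ≤ ∫⁻ x, c ^ 2 * (∫⁻ y, F y * G (x - y)) ^ 2 := by
          refine lintegral_mono fun x ↦ ?_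
          rw [← mul_pow]
          exact pow_le_pow_left' (hpointwise x) 2
      _ = c ^ 2 * ∫⁻ x, (∫⁻ y, F y * G (x - y)) ^ 2 :=
          lintegral_const_mul _ ((Measurable.lintegral_prod_right (by fun_prop)).pow_const 2)
      _ ≤ c ^ 2 * ((∫⁻ y, F y) ^ 2 * ∫⁻ z, G z ^ 2) := by
          gcongr
          exact lintegral_sq_conv_le hF hG
      _ = _ := by rw [mul_pow, mul_assoc]
  refine (ENNReal.rpow_le_rpow hmain (by norm_num)).trans_eq ?_
  rw [ENNReal.mul_rpow_of_nonneg _ _ (by norm_num), ← ENNReal.rpow_natCast, ← ENNReal.rpow_mul]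
  norm_num
  rfl
end

section
/- Let V and Ṽ be closed cones in ℝ^n with V \ {0} ⊆ int Ṽ. Then there exists c with 0 < c < 1 such that {x ∈ ℝ^n : there exists y ∈ V with |x − y| < c|y|} ⊆ int Ṽ. -/
/-- A cone in a real vector space: closed under multiplication by positive scalars. -/
def IsConeSet {E : Type*} [SMul ℝ E] (V : Set E) : Prop :=
  ∀ ⦃x⦄, x ∈ V → ∀ ⦃lam : ℝ⦄, 0 < lam → lam • x ∈ V

open scoped Pointwise in
/-- The interior of a cone is a cone. -/
theorem IsConeSet.interior {E : Type*} [NormedAddCommGroup E] [NormedSpace ℝ E] {V : Set E}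
    (hV : IsConeSet V) : IsConeSet (interior V) := by
  intro x hx r hr
  have hsub : r • V ⊆ V := by
    rintro _ ⟨y, hy, rfl⟩
    exact hV hy hr
  apply interior_mono hsub
  rw [interior_smul₀ hr.ne']
  exact Set.smul_mem_smul_set hx

theorem stmt_6 {n : ℕ} (V Vt : Set (EuclideanSpace ℝ (Fin n)))
    (hVcl : IsClosed V) (hVcone : IsConeSet V)
    (hVtcl : IsClosed Vt) (hVtcone : IsConeSet Vt)
    (h : V \ {0} ⊆ interior Vt) :
    ∃ c : ℝ, 0 < c ∧ c < 1 ∧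
      {x : EuclideanSpace ℝ (Fin n) | ∃ y ∈ V, ‖x - y‖ < c * ‖y‖} ⊆ interior Vt := by
  have hK : IsCompact (Metric.sphere (0 : EuclideanSpace ℝ (Fin n)) 1 ∩ V) :=
    (isCompact_sphere 0 1).inter_right hVcl
  have hKV : Metric.sphere (0 : EuclideanSpace ℝ (Fin n)) 1 ∩ V ⊆ interior Vt :=
    fun x hx => h ⟨hx.2, ne_zero_of_mem_unit_sphere ⟨x, hx.1⟩⟩
  obtain ⟨δ, hδ, hsub⟩ := hK.exists_thickening_subset_open isOpen_interior hKV
  refine ⟨min δ (1 / 2), by positivity, (min_le_right _ _).trans_lt (by norm_num), ?_⟩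
  rintro x ⟨y, hy, hxy⟩
  have hy0 : 0 < ‖y‖ := by
    by_contra! hle
    have hzero : ‖y‖ = 0 := le_antisymm hle (norm_nonneg y)
    rw [hzero, mul_zero] at hxy
    exact (norm_nonneg _).not_gt hxy
  have hmem : ‖y‖⁻¹ • x ∈ interior Vt := by
    apply hsub
    rw [Metric.mem_thickening_iff]
    refine ⟨‖y‖⁻¹ • y, ⟨?_, hVcone hy (inv_pos.2 hy0)⟩, ?_⟩
    · rw [mem_sphere_zero_iff_norm, norm_smul, norm_inv, norm_norm, inv_mul_cancel₀ hy0.ne']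
    · rw [dist_eq_norm, ← smul_sub, norm_smul, norm_inv, norm_norm, inv_mul_lt_iff₀ hy0,
        mul_comm]
      exact hxy.trans_le (mul_le_mul_of_nonneg_right (min_le_left _ _) hy0.le)
  simpa [smul_smul, mul_inv_cancel₀ hy0.ne'] using hVtcone.interior hmem hy0
end

section
/- Let W₁ ⊆ ℝ^m \ {0} and W₂ ⊆ ℝ^n \ {0} be cones such that W₁ ∪ {0} and W₂ ∪ {0} are closed in ℝ^m and ℝ^n respectively, and let Ṽ ⊆ ℝ^{m+n} be a closed cone such that ((W₁ ∪ {0}) × (W₂ ∪ {0})) ∩ (Ṽ \ {0}) = ∅ (identifying ℝ^m × ℝ^n with ℝ^{m+n}). Then there exist cones W₁' ⊆ ℝ^m \ {0} and W₂' ⊆ ℝ^n \ {0} with W₁' ∪ {0} and W₂' ∪ {0} closed, W₁ ⊆ int W₁', W₂ ⊆ int W₂', and ((W₁' ∪ {0}) × (W₂' ∪ {0})) ∩ (Ṽ \ {0}) = ∅. -/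
open Metric

theorem IsConeSet.union_zero {E : Type*} [AddCommGroup E] [Module ℝ E] {W : Set E}
    (hW : IsConeSet W) : IsConeSet (W ∪ {0}) := by
  rintro x (hx | rfl) lam hlam
  · exact Or.inl (hW hx hlam)
  · exact Or.inr (smul_zero lam)

section ConicNeighborhood

variable {E : Type*} [NormedAddCommGroup E]

/-- The closed conic neighborhood of aperture `ε` of a set `C`. -/
def conicThickening (ε : ℝ) (C : Set E) : Set E :=
  {x | infDist x C ≤ ε * ‖x‖}

theorem isClosed_conicThickening (ε : ℝ) (C : Set E) : IsClosed (conicThickening ε C) :=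
  isClosed_le (continuous_infDist_pt C) (by fun_prop)

theorem zero_mem_conicThickening (ε : ℝ) {C : Set E} (h0 : (0 : E) ∈ C) :
    (0 : E) ∈ conicThickening ε C := by
  simp [conicThickening, infDist_zero_of_mem h0]

theorem subset_interior_conicThickening_diff_zero {ε : ℝ} (hε : 0 < ε) {C W : Set E}
    (hWC : W ⊆ C) (h0 : (0 : E) ∉ W) : W ⊆ interior (conicThickening ε C \ {0}) := by
  have hopen : IsOpen {x : E | infDist x C < ε * ‖x‖} :=
    isOpen_lt (continuous_infDist_pt C) (by fun_prop)
  intro x hx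
  refine interior_maximal ?_ hopen ?_
  · intro y (hy : infDist y C < ε * ‖y‖)
    refine ⟨hy.le, ?_⟩
    rintro rfl
    rw [norm_zero, mul_zero] at hy
    exact hy.not_ge infDist_nonneg
  · have hx0 : x ≠ 0 := fun h => h0 (h ▸ hx)
    change infDist x C < ε * ‖x‖
    rw [infDist_zero_of_mem (hWC hx)]
    positivity

variable [NormedSpace ℝ E]

theorem IsConeSet.infDist_smul_le {C : Set E} (hC : IsConeSet C) (hne : C.Nonempty) (x : E)
    {c : ℝ} (hc : 0 < c) : infDist (c • x) C ≤ c * infDist x C := by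
  rw [← div_le_iff₀' hc, le_infDist hne]
  intro y hy
  rw [div_le_iff₀' hc]
  calc infDist (c • x) C ≤ dist (c • x) (c • y) := infDist_le_dist_of_mem (hC hy hc)
    _ = c * dist x y := by rw [dist_smul₀, Real.norm_of_nonneg hc.le]

theorem IsConeSet.conicThickening {C : Set E} (hC : IsConeSet C) (hne : C.Nonempty) (ε : ℝ) :
    IsConeSet (conicThickening ε C) := by
  intro x (hx : infDist x C ≤ ε * ‖x‖) c hc
  change infDist (c • x) C ≤ ε * ‖c • x‖
  rw [norm_smul, Real.norm_of_nonneg hc.le]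
  calc infDist (c • x) C ≤ c * infDist x C := hC.infDist_smul_le hne x hc
    _ ≤ c * (ε * ‖x‖) := by gcongr
    _ = ε * (c * ‖x‖) := by ring

theorem IsConeSet.diff_zero {W : Set E} (hW : IsConeSet W) : IsConeSet (W \ {0}) :=
  fun _ hx _ hc => ⟨hW hx.1 hc, smul_ne_zero hc.ne' hx.2⟩

/-- A closed cone in a product that meets the product of two closed cones only at the origin
also meets the product of sufficiently small conic neighborhoods only at the origin. -/
theorem exists_conicThickening_prod_disjoint {F : Type*} [NormedAddCommGroup F]
    [NormedSpace ℝ F] [ProperSpace E] [ProperSpace F] {C : Set E} {D : Set F} {V : Set (E × F)}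
    (hC : IsConeSet C) (hD : IsConeSet D) (hV : IsConeSet V)
    (hCcl : IsClosed C) (hDcl : IsClosed D) (hVcl : IsClosed V)
    (hCne : C.Nonempty) (hDne : D.Nonempty)
    (hdisj : ∀ p ∈ V, p.1 ∈ C → p.2 ∈ D → p = 0) :
    ∃ ε > 0, ∀ p ∈ V, p.1 ∈ conicThickening ε C → p.2 ∈ conicThickening ε D →
      p = 0 := by
  have hK : IsCompact (sphere (0 : E × F) 1 ∩ V) := (isCompact_sphere 0 1).inter_right hVcl
  have hcont : Continuous fun p : E × F => infDist p.1 C + infDist p.2 D :=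
    ((continuous_infDist_pt C).comp continuous_fst).add
      ((continuous_infDist_pt D).comp continuous_snd)
  obtain ⟨δ, hδ, hmin⟩ := hK.exists_forall_le' (a := 0) hcont.continuousOn (by
    rintro p ⟨hp1, hpV⟩
    by_contra! hle
    have h1 : infDist p.1 C = 0 := by
      linarith [infDist_nonneg (x := p.1) (s := C), infDist_nonneg (x := p.2) (s := D)]
    have h2 : infDist p.2 D = 0 := by
      linarith [infDist_nonneg (x := p.1) (s := C), infDist_nonneg (x := p.2) (s := D)]
    have hp0 : p = 0 := hdisj p hpV ((hCcl.mem_iff_infDist_zero hCne).2 h1)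
      ((hDcl.mem_iff_infDist_zero hDne).2 h2)
    simp [hp0] at hp1)
  refine ⟨δ / 3, by positivity, fun p hpV hpC hpD => ?_⟩
  by_contra hp0
  have hc : 0 < ‖p‖⁻¹ := inv_pos.2 (norm_pos_iff.2 hp0)
  have hnorm : ‖‖p‖⁻¹ • p‖ = 1 := norm_smul_inv_norm (𝕜 := ℝ) hp0
  have hle := hmin (‖p‖⁻¹ • p) ⟨by simpa using hnorm, hV hpV hc⟩
  have h1 : infDist (‖p‖⁻¹ • p).1 C ≤ δ / 3 * ‖(‖p‖⁻¹ • p).1‖ :=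
    hC.conicThickening hCne (δ / 3) hpC hc
  have h2 : infDist (‖p‖⁻¹ • p).2 D ≤ δ / 3 * ‖(‖p‖⁻¹ • p).2‖ :=
    hD.conicThickening hDne (δ / 3) hpD hc
  have h3 := (norm_fst_le (‖p‖⁻¹ • p)).trans_eq hnorm
  have h4 := (norm_snd_le (‖p‖⁻¹ • p)).trans_eq hnorm
  nlinarith

end ConicNeighborhood

section Concat

variable {m n : ℕ}

theorem concatE_apply_castAdd (ξ : EuclideanSpace ℝ (Fin m)) (η : EuclideanSpace ℝ (Fin n))
    (i : Fin m) : concatE ξ η (Fin.castAdd n i) = ξ i :=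
  Fin.append_left (fun i => ξ i) (fun j => η j) i

theorem concatE_apply_natAdd (ξ : EuclideanSpace ℝ (Fin m)) (η : EuclideanSpace ℝ (Fin n))
    (j : Fin n) : concatE ξ η (Fin.natAdd m j) = η j :=
  Fin.append_right (fun i => ξ i) (fun j => η j) j

theorem concatE_smul (c : ℝ) (ξ : EuclideanSpace ℝ (Fin m)) (η : EuclideanSpace ℝ (Fin n)) :
    concatE (c • ξ) (c • η) = c • concatE ξ η := by
  ext k
  induction k using Fin.addCases <;> simp [concatE_apply_castAdd, concatE_apply_natAdd]

theorem concatE_eq_zero_iff {ξ : EuclideanSpace ℝ (Fin m)} {η : EuclideanSpace ℝ (Fin n)} :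
    concatE ξ η = 0 ↔ ξ = 0 ∧ η = 0 := by
  constructor
  · intro h
    constructor
    · ext i
      rw [← concatE_apply_castAdd ξ η i, h]
      rfl
    · ext j
      rw [← concatE_apply_natAdd ξ η j, h]
      rfl
  · rintro ⟨rfl, rfl⟩
    simpa using concatE_smul 0 (0 : EuclideanSpace ℝ (Fin m)) (0 : EuclideanSpace ℝ (Fin n))

theorem continuous_concatE :
    Continuous fun p : EuclideanSpace ℝ (Fin m) × EuclideanSpace ℝ (Fin n) =>
      concatE p.1 p.2 := by
  refine (EuclideanSpace.equiv (Fin (m + n)) ℝ).symm.continuous.comp (continuous_pi fun k => ?_)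
  induction k using Fin.addCases with
  | left i => simp only [Fin.append_left]; fun_prop
  | right j => simp only [Fin.append_right]; fun_prop

end Concat


theorem stmt_7 {m n : ℕ}
    (W₁ : Set (EuclideanSpace ℝ (Fin m))) (W₂ : Set (EuclideanSpace ℝ (Fin n)))
    (Vt : Set (EuclideanSpace ℝ (Fin (m + n))))
    (hW₁0 : (0 : EuclideanSpace ℝ (Fin m)) ∉ W₁) (hW₂0 : (0 : EuclideanSpace ℝ (Fin n)) ∉ W₂)
    (hW₁cone : IsConeSet W₁) (hW₂cone : IsConeSet W₂)
    (hW₁cl : IsClosed (W₁ ∪ {0})) (hW₂cl : IsClosed (W₂ ∪ {0}))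
    (hVtcl : IsClosed Vt) (hVtcone : IsConeSet Vt)
    (hdisj : ∀ ξ ∈ W₁ ∪ {0}, ∀ η ∈ W₂ ∪ {0}, concatE ξ η ∉ Vt \ {0}) :
    ∃ (W₁' : Set (EuclideanSpace ℝ (Fin m))) (W₂' : Set (EuclideanSpace ℝ (Fin n))),
      (0 : EuclideanSpace ℝ (Fin m)) ∉ W₁' ∧ (0 : EuclideanSpace ℝ (Fin n)) ∉ W₂' ∧
      IsConeSet W₁' ∧ IsConeSet W₂' ∧
      IsClosed (W₁' ∪ {0}) ∧ IsClosed (W₂' ∪ {0}) ∧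
      W₁ ⊆ interior W₁' ∧ W₂ ⊆ interior W₂' ∧
      ∀ ξ ∈ W₁' ∪ {0}, ∀ η ∈ W₂' ∪ {0}, concatE ξ η ∉ Vt \ {0} := by
  have hz₁ : (0 : EuclideanSpace ℝ (Fin m)) ∈ W₁ ∪ {0} := Or.inr rfl
  have hz₂ : (0 : EuclideanSpace ℝ (Fin n)) ∈ W₂ ∪ {0} := Or.inr rfl
  obtain ⟨ε, hε, hsep⟩ := exists_conicThickening_prod_disjoint
    (V := (fun p : EuclideanSpace ℝ (Fin m) × EuclideanSpace ℝ (Fin n) =>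
      concatE p.1 p.2) ⁻¹' Vt)
    hW₁cone.union_zero hW₂cone.union_zero
    (fun p hp c hc => by
      change concatE (c • p.1) (c • p.2) ∈ Vt
      rw [concatE_smul]
      exact hVtcone hp hc)
    hW₁cl hW₂cl (hVtcl.preimage continuous_concatE) ⟨0, hz₁⟩ ⟨0, hz₂⟩
    (fun p hpV hp₁ hp₂ => by
      by_contra hp0
      exact hdisj p.1 hp₁ p.2 hp₂
        ⟨hpV, fun h => hp0 (Prod.ext_iff.2 (concatE_eq_zero_iff.1 h))⟩)
  have hu₁ : conicThickening ε (W₁ ∪ {0}) \ {0} ∪ {0} = conicThickening ε (W₁ ∪ {0}) :=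
    Set.sdiff_union_of_subset (Set.singleton_subset_iff.2 (zero_mem_conicThickening ε hz₁))
  have hu₂ : conicThickening ε (W₂ ∪ {0}) \ {0} ∪ {0} = conicThickening ε (W₂ ∪ {0}) :=
    Set.sdiff_union_of_subset (Set.singleton_subset_iff.2 (zero_mem_conicThickening ε hz₂))
  refine ⟨conicThickening ε (W₁ ∪ {0}) \ {0}, conicThickening ε (W₂ ∪ {0}) \ {0},
    fun h => h.2 rfl, fun h => h.2 rfl,
    (hW₁cone.union_zero.conicThickening ⟨0, hz₁⟩ ε).diff_zero,
    (hW₂cone.union_zero.conicThickening ⟨0, hz₂⟩ ε).diff_zero,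
    hu₁.symm ▸ isClosed_conicThickening ε (W₁ ∪ {0}),
    hu₂.symm ▸ isClosed_conicThickening ε (W₂ ∪ {0}),
    subset_interior_conicThickening_diff_zero hε Set.subset_union_left hW₁0,
    subset_interior_conicThickening_diff_zero hε Set.subset_union_left hW₂0, ?_⟩
  rw [hu₁, hu₂]
  rintro ξ hξ η hη ⟨hV, hne⟩
  exact hne (concatE_eq_zero_iff.2 (Prod.ext_iff.1 (hsep (ξ, η) hV hξ hη)))
end

section
/- Let W₁ ⊆ ℝ^m \ {0} and W₂ ⊆ ℝ^n \ {0} be cones such that W₁ ∪ {0} and W₂ ∪ {0} are closed, let Ṽ ⊆ ℝ^{m+n} be a closed cone, and let ε ∈ (0,1) satisfy ( ((W₁ ∪ {0}) × (W₂ ∪ {0})) ∩ 𝕊^{m+n−1} + B̄_{m+n}(ε) ) ∩ Ṽ = ∅, where 𝕊^{m+n−1} is the unit sphere of ℝ^{m+n} and B̄_k(ε) is the closed ball of radius ε centered at 0 in ℝ^k, and + denotes the Minkowski sum. Define W₁' := ⋃_{λ>0} λ(W₁ ∩ 𝕊^{m−1} + B̄_m(ε)) and W₂' := ⋃_{λ>0}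 λ(W₂ ∩ 𝕊^{n−1} + B̄_n(ε)). Then W₁' ⊆ ℝ^m \ {0} and W₂' ⊆ ℝ^n \ {0} are cones, W₁' ∪ {0} and W₂' ∪ {0} are closed, W₁ ⊆ int W₁', W₂ ⊆ int W₂', and ((W₁' ∪ {0}) × (W₂' ∪ {0})) ∩ (Ṽ \ {0}) = ∅. -/
open scoped Pointwise

open Metric Set Filter Topology in
/-- A closed set `C` in a proper space has closed relative `ε`-enlargement when `ε < 1`. -/
theorem isClosed_relative_thickening {E : Type*} [NormedAddCommGroup E] [ProperSpace E]
    {C : Set E} {ε : ℝ} (hC : IsClosed C) (hε : ε < 1) :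
    IsClosed {x : E | ∃ w ∈ C, ‖x - w‖ ≤ ε * ‖w‖} := by
  refine IsSeqClosed.isClosed fun x a hx hxa => ?_
  choose w hwC hw using hx
  obtain ⟨R, hR⟩ := hxa.norm.bddAbove_range
  have hbound : ∀ k, w k ∈ closedBall (0 : E) (R / (1 - ε)) := fun k => by
    rw [mem_closedBall_zero_iff, le_div_iff₀ (by linarith)]
    have hxR : ‖x k‖ ≤ R := hR ⟨k, rfl⟩
    have htri := norm_sub_norm_le (w k) (x k)
    rw [norm_sub_rev] at htri
    linarith [hw k]
  obtain ⟨b, -, φ, hφ, hb⟩ := (isCompact_closedBall (0 : E) _).tendsto_subseq hbound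
  refine ⟨b, hC.mem_of_tendsto hb (Eventually.of_forall fun k => hwC _), ?_⟩
  exact le_of_tendsto_of_tendsto' ((hxa.comp hφ.tendsto_atTop).sub hb).norm
    (hb.norm.const_mul ε) fun k => hw _

section ConicEnlargement

variable {E : Type*} [NormedAddCommGroup E] [NormedSpace ℝ E] {W : Set E} {ε : ℝ}

/-- The cone generated by the `ε`-neighbourhood of the unit vectors of a set `W`. -/
def conicEnlargement (W : Set E) (ε : ℝ) : Set E :=
  ⋃ lam ∈ Set.Ioi (0 : ℝ),
    lam • ((W ∩ Metric.sphere (0 : E) 1) + Metric.closedBall (0 : E) ε)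

theorem mem_conicEnlargement (h0 : (0 : E) ∉ W) (hW : IsConeSet W) {x : E} :
    x ∈ conicEnlargement W ε ↔ ∃ w ∈ W, ‖x - w‖ ≤ ε * ‖w‖ := by
  simp only [conicEnlargement, Set.mem_iUnion, Set.mem_Ioi, exists_prop]
  constructor
  · rintro ⟨lam, hlam, _, ⟨u, ⟨huW, hu⟩, a, ha, rfl⟩, rfl⟩
    rw [mem_sphere_zero_iff_norm] at hu
    rw [mem_closedBall_zero_iff] at ha
    refine ⟨lam • u, hW huW hlam, ?_⟩
    simp only [smul_add, add_sub_cancel_left, norm_smul, Real.norm_of_nonneg hlam.le, hu]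
    nlinarith
  · rintro ⟨w, hw, hxw⟩
    have hw0 : 0 < ‖w‖ := norm_pos_iff.2 fun h => h0 (h ▸ hw)
    refine ⟨‖w‖, hw0, ‖w‖⁻¹ • x, ?_, smul_inv_smul₀ hw0.ne' x⟩
    refine ⟨‖w‖⁻¹ • w, ⟨hW hw (inv_pos.2 hw0), ?_⟩, ‖w‖⁻¹ • (x - w), ?_, ?_⟩
    · rw [mem_sphere_zero_iff_norm, norm_smul, norm_inv, norm_norm, inv_mul_cancel₀ hw0.ne']
    · rw [mem_closedBall_zero_iff, norm_smul, norm_inv, norm_norm, inv_mul_le_iff₀ hw0]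
      linarith
    · simp [smul_sub]

theorem mem_conicEnlargement_union_zero (h0 : (0 : E) ∉ W) (hW : IsConeSet W) {x : E} :
    x ∈ conicEnlargement W ε ∪ {0} ↔ ∃ w ∈ W ∪ {0}, ‖x - w‖ ≤ ε * ‖w‖ := by
  rw [Set.mem_union, mem_conicEnlargement h0 hW]
  simp [or_and_right, exists_or, or_comm]

theorem zero_notMem_conicEnlargement (h0 : (0 : E) ∉ W) (hW : IsConeSet W) (hε : ε < 1) :
    (0 : E) ∉ conicEnlargement W ε := by
  rw [mem_conicEnlargement h0 hW]
  rintro ⟨w, hw, h⟩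
  have hw0 : 0 < ‖w‖ := norm_pos_iff.2 fun h => h0 (h ▸ hw)
  rw [zero_sub, norm_neg] at h
  nlinarith

theorem isConeSet_conicEnlargement (h0 : (0 : E) ∉ W) (hW : IsConeSet W) :
    IsConeSet (conicEnlargement W ε) := by
  intro x hx lam hlam
  rw [mem_conicEnlargement h0 hW] at hx ⊢
  obtain ⟨w, hw, h⟩ := hx
  refine ⟨lam • w, hW hw hlam, ?_⟩
  rw [← smul_sub, norm_smul, norm_smul, mul_left_comm]
  gcongr

theorem isClosed_conicEnlargement_union_zero [ProperSpace E] (h0 : (0 : E) ∉ W)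
    (hW : IsConeSet W) (hcl : IsClosed (W ∪ {0})) (hε : ε < 1) :
    IsClosed (conicEnlargement W ε ∪ {0}) := by
  convert isClosed_relative_thickening hcl hε using 1
  ext x
  exact mem_conicEnlargement_union_zero h0 hW

theorem subset_interior_conicEnlargement (h0 : (0 : E) ∉ W) (hW : IsConeSet W) (hε : 0 < ε) :
    W ⊆ interior (conicEnlargement W ε) := by
  intro w hw
  have hw0 : 0 < ‖w‖ := norm_pos_iff.2 fun h => h0 (h ▸ hw)
  refine mem_interior.2 ⟨Metric.ball w (ε * ‖w‖), fun x hx => ?_, Metric.isOpen_ball,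
    Metric.mem_ball_self (by positivity)⟩
  rw [mem_ball_iff_norm] at hx
  exact (mem_conicEnlargement h0 hW).2 ⟨w, hw, hx.le⟩

end ConicEnlargement

theorem IsConeSet.smul_mem_union_zero {E : Type*} [AddCommGroup E] [Module ℝ E] {W : Set E}
    (hW : IsConeSet W) {x : E} (hx : x ∈ W ∪ {0}) {lam : ℝ} (hlam : 0 < lam) :
    lam • x ∈ W ∪ {0} := by
  rcases hx with hx | rfl
  · exact Or.inl (hW hx hlam)
  · simp

section ConcatE

variable {m n : ℕ}

theorem norm_sq_concatE (ξ : EuclideanSpace ℝ (Fin m)) (η : EuclideanSpace ℝ (Fin n)) :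
    ‖concatE ξ η‖ ^ 2 = ‖ξ‖ ^ 2 + ‖η‖ ^ 2 := by
  simp [EuclideanSpace.norm_sq_eq, concatE, Fin.sum_univ_add]

theorem concatE_sub (ξ ξ' : EuclideanSpace ℝ (Fin m)) (η η' : EuclideanSpace ℝ (Fin n)) :
    concatE ξ η - concatE ξ' η' = concatE (ξ - ξ') (η - η') := by
  ext i
  refine Fin.addCases (fun i => ?_) (fun i => ?_) i <;> simp [concatE]

theorem smul_concatE (c : ℝ) (ξ : EuclideanSpace ℝ (Fin m)) (η : EuclideanSpace ℝ (Fin n)) :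
    c • concatE ξ η = concatE (c • ξ) (c • η) := by
  ext i
  refine Fin.addCases (fun i => ?_) (fun i => ?_) i <;> simp [concatE]

theorem norm_concatE_sub_le {ε : ℝ} (hε : 0 ≤ ε) {ξ u : EuclideanSpace ℝ (Fin m)}
    {η v : EuclideanSpace ℝ (Fin n)} (hξ : ‖ξ - u‖ ≤ ε * ‖u‖) (hη : ‖η - v‖ ≤ ε * ‖v‖) :
    ‖concatE ξ η - concatE u v‖ ≤ ε * ‖concatE u v‖ := by
  rw [← sq_le_sq₀ (norm_nonneg _) (by positivity), mul_pow, concatE_sub, norm_sq_concatE,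
    norm_sq_concatE, mul_add, ← mul_pow, ← mul_pow]
  gcongr

end ConcatE

theorem stmt_8 {m n : ℕ}
    (W₁ : Set (EuclideanSpace ℝ (Fin m))) (W₂ : Set (EuclideanSpace ℝ (Fin n)))
    (Vt : Set (EuclideanSpace ℝ (Fin (m + n)))) (ε : ℝ) (hε0 : 0 < ε) (hε1 : ε < 1)
    (hW₁0 : (0 : EuclideanSpace ℝ (Fin m)) ∉ W₁) (hW₂0 : (0 : EuclideanSpace ℝ (Fin n)) ∉ W₂)
    (hW₁cone : IsConeSet W₁) (hW₂cone : IsConeSet W₂)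
    (hW₁cl : IsClosed (W₁ ∪ {0})) (hW₂cl : IsClosed (W₂ ∪ {0}))
    (hVtcl : IsClosed Vt) (hVtcone : IsConeSet Vt)
    (hsep :
      (((fun p : EuclideanSpace ℝ (Fin m) × EuclideanSpace ℝ (Fin n) => concatE p.1 p.2) ''
            ((W₁ ∪ {0}) ×ˢ (W₂ ∪ {0})) ∩
          Metric.sphere (0 : EuclideanSpace ℝ (Fin (m + n))) 1)
        + Metric.closedBall (0 : EuclideanSpace ℝ (Fin (m + n))) ε) ∩ Vt = ∅)
    (W₁' : Set (EuclideanSpace ℝ (Fin m))) (W₂' : Set (EuclideanSpace ℝ (Fin n)))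
    (hW₁' : W₁' = ⋃ lam ∈ Set.Ioi (0 : ℝ),
      lam • ((W₁ ∩ Metric.sphere (0 : EuclideanSpace ℝ (Fin m)) 1)
        + Metric.closedBall (0 : EuclideanSpace ℝ (Fin m)) ε))
    (hW₂' : W₂' = ⋃ lam ∈ Set.Ioi (0 : ℝ),
      lam • ((W₂ ∩ Metric.sphere (0 : EuclideanSpace ℝ (Fin n)) 1)
        + Metric.closedBall (0 : EuclideanSpace ℝ (Fin n)) ε)) :
    (0 : EuclideanSpace ℝ (Fin m)) ∉ W₁' ∧ (0 : EuclideanSpace ℝ (Fin n)) ∉ W₂' ∧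
    IsConeSet W₁' ∧ IsConeSet W₂' ∧
    IsClosed (W₁' ∪ {0}) ∧ IsClosed (W₂' ∪ {0}) ∧
    W₁ ⊆ interior W₁' ∧ W₂ ⊆ interior W₂' ∧
    ∀ ξ ∈ W₁' ∪ {0}, ∀ η ∈ W₂' ∪ {0}, concatE ξ η ∉ Vt \ {0} := by
  change W₁' = conicEnlargement W₁ ε at hW₁'
  change W₂' = conicEnlargement W₂ ε at hW₂'
  subst hW₁' hW₂'
  refine ⟨zero_notMem_conicEnlargement hW₁0 hW₁cone hε1,
    zero_notMem_conicEnlargement hW₂0 hW₂cone hε1,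
    isConeSet_conicEnlargement hW₁0 hW₁cone, isConeSet_conicEnlargement hW₂0 hW₂cone,
    isClosed_conicEnlargement_union_zero hW₁0 hW₁cone hW₁cl hε1,
    isClosed_conicEnlargement_union_zero hW₂0 hW₂cone hW₂cl hε1,
    subset_interior_conicEnlargement hW₁0 hW₁cone hε0,
    subset_interior_conicEnlargement hW₂0 hW₂cone hε0, ?_⟩
  rintro ξ hξ η hη ⟨hV, hne⟩
  obtain ⟨u, hu, hξu⟩ := (mem_conicEnlargement_union_zero hW₁0 hW₁cone).1 hξ
  obtain ⟨v, hv, hηv⟩ := (mem_conicEnlargement_union_zero hW₂0 hW₂cone).1 hη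
  have hle := norm_concatE_sub_le hε0.le hξu hηv
  have hpos : 0 < ‖concatE u v‖ := by
    refine norm_pos_iff.2 fun h => hne ?_
    rw [h, norm_zero, mul_zero, sub_zero] at hle
    exact norm_le_zero_iff.1 hle
  have hc := inv_pos.2 hpos
  set c := ‖concatE u v‖⁻¹ with hc_def
  refine hsep.subset ⟨⟨c • concatE u v, ⟨⟨(c • u, c • v),
    ⟨hW₁cone.smul_mem_union_zero hu hc, hW₂cone.smul_mem_union_zero hv hc⟩,
    (smul_concatE c u v).symm⟩, ?_⟩, c • (concatE ξ η - concatE u v), ?_, ?_⟩, hVtcone hV hc⟩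
  · rw [mem_sphere_zero_iff_norm, norm_smul, Real.norm_of_nonneg hc.le, hc_def,
      inv_mul_cancel₀ hpos.ne']
  · rw [mem_closedBall_zero_iff, norm_smul, Real.norm_of_nonneg hc.le, hc_def,
      inv_mul_le_iff₀ hpos]
    linarith
  · simp [smul_sub]
end
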